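/- arXiv:2304.13675 — 2 statements merged into one kernel-verified Lean document; each statement's English description precedes it below -/
import Mathlib

section
/- Let k ≥ 2 and let G be a graph on vertex set V. Then the facets of Δ_{k+1}(G) are exactly those faces of Δ_k(G) of dimension one less than dim Δ_k(G) (i.e., of size |V| - k - 1) that are contained in at least k facets of Δ_k(G). -/
open Finset

/-- The induced subgraph of `G` on the vertex set `S` is disconnected. -/
def IsDisconn {V : Type*} (G : SimpleGraph V) (S : Finset V) : Prop :=
  ¬ (G.induce (S : Set V)).Connected

/-- `σ` is a face of the k-cut complex `Δ_k(G)`: the complement of `σ`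
contains a `k`-subset inducing a disconnected subgraph. -/
def IsFace {V : Type*} [Fintype V] [DecidableEq V] (G : SimpleGraph V) (k : ℕ)
    (σ : Finset V) : Prop :=
  ∃ S : Finset V, S ⊆ σᶜ ∧ S.card = k ∧ IsDisconn G S

/-- `F` is a facet of the k-cut complex `Δ_k(G)`: the complement of `F` is a
disconnected `k`-set. -/
def IsFacet {V : Type*} [Fintype V] [DecidableEq V] (G : SimpleGraph V) (k : ℕ)
    (F : Finset V) : Prop :=
  Fᶜ.card = k ∧ IsDisconn G Fᶜ

/-- A list of the facets of a pure complex is a shelling order. -/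
def IsShelling {V : Type*} [DecidableEq V] (l : List (Finset V)) : Prop :=
  ∀ i j : ℕ, i < j → j < l.length →
    ∃ m, m < j ∧ (l.getD i ∅ ∩ l.getD j ∅ ⊆ l.getD m ∅ ∩ l.getD j ∅) ∧
      (l.getD m ∅ ∩ l.getD j ∅).card + 1 = (l.getD j ∅).card

/-- A complex, given by its facet predicate, is shellable. -/
def Shellable {V : Type*} [DecidableEq V] (Fac : Finset V → Prop) : Prop :=
  ∃ l : List (Finset V), l.Nodup ∧ (∀ F, F ∈ l ↔ Fac F) ∧ IsShelling l

/-- A finite nontrivial connected graph has two distinct non-cut vertices. -/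
lemma SimpleGraph.Connected.exists_ne_connected_induce_compl_singleton {V : Type*} [Finite V]
    [Nontrivial V] {G : SimpleGraph V} (hG : G.Connected) :
    ∃ u v : V, u ≠ v ∧ (G.induce {u}ᶜ).Connected ∧ (G.induce {v}ᶜ).Connected := by
  classical
  have := Fintype.ofFinite V
  obtain ⟨T, hTG, hT⟩ := hG.exists_isTree_le
  obtain ⟨u, v, huv, hu, hv⟩ := hT.exists_ne_and_degree_eq_one
  exact ⟨u, v, huv,
    (hT.connected.induce_compl_singleton_of_degree_eq_one hu).mono fun _ _ h => hTG h,
    (hT.connected.induce_compl_singleton_of_degree_eq_one hv).mono fun _ _ h => hTG h⟩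

lemma connected_induce_erase {V : Type*} [DecidableEq V] {G : SimpleGraph V} {S : Finset V}
    (x : (S : Set V)) (h : ((G.induce (S : Set V)).induce {x}ᶜ).Connected) :
    ¬ IsDisconn G (S.erase x) := by
  let f : (G.induce (S : Set V)).induce {x}ᶜ →g G.induce (S.erase x : Set V) :=
    { toFun := fun y => ⟨y.1.1, by
        have hy : y.1 ≠ x := y.2
        exact Finset.mem_coe.2
          (Finset.mem_erase.2 ⟨fun he => hy (Subtype.ext he), y.1.2⟩)⟩
      map_rel' := fun h => h }
  refine not_not.2 (h.map f ?_)
  rintro ⟨y, hy⟩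
  have hy' := Finset.mem_erase.1 (Finset.mem_coe.1 hy)
  exact ⟨⟨⟨y, hy'.2⟩, fun he => hy'.1 (congrArg Subtype.val he)⟩, rfl⟩

lemma exists_ne_not_isDisconn_erase {V : Type*} [DecidableEq V] {G : SimpleGraph V}
    {S : Finset V} (hS : 1 < S.card) (h : ¬ IsDisconn G S) :
    ∃ u ∈ S, ∃ v ∈ S, u ≠ v ∧ ¬ IsDisconn G (S.erase u) ∧ ¬ IsDisconn G (S.erase v) := by
  have : Nontrivial (S : Set V) := Set.nontrivial_coe_sort.2 (Finset.one_lt_card_iff_nontrivial.1 hS)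
  obtain ⟨u, v, huv, hu, hv⟩ :=
    (not_not.1 h).exists_ne_connected_induce_compl_singleton
  exact ⟨u, u.2, v, v.2, fun he => huv (Subtype.ext he), connected_induce_erase u hu,
    connected_induce_erase v hv⟩

/-- A vertex whose removal makes a disconnected set connected is isolated in that set. -/
lemma not_adj_of_isDisconn {V : Type*} [DecidableEq V] {G : SimpleGraph V} {S : Finset V}
    (h : IsDisconn G S) {x y : V} (hx : x ∈ S) (hy : y ∈ S) (hxS : ¬ IsDisconn G (S.erase x)) :
    ¬ G.Adj x y := by
  intro hadj
  apply h
  have hyx : y ∈ ((S.erase x : Finset V) : Set V) :=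
    Finset.mem_coe.2 (Finset.mem_erase.2 ⟨hadj.ne', hy⟩)
  have key := G.connected_induce_union (SimpleGraph.Preconnected.of_subsingleton)
    (not_not.1 hxS).preconnected (Set.mem_singleton x) hyx hadj
  have hset : {x} ∪ ((S.erase x : Finset V) : Set V) = S := by
    rw [Set.singleton_union, ← Finset.coe_insert, Finset.insert_erase hx]
  rwa [hset] at key

lemma eq_of_not_isDisconn_erase {V : Type*} [DecidableEq V] {G : SimpleGraph V} {S : Finset V}
    (hS : 2 < S.card) (h : IsDisconn G S) {u v : V} (hu : u ∈ S) (hv : v ∈ S)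
    (hu' : ¬ IsDisconn G (S.erase u)) (hv' : ¬ IsDisconn G (S.erase v)) : u = v := by
  by_contra huv
  have hvu : v ∈ ((S.erase u : Finset V) : Set V) :=
    Finset.mem_coe.2 (Finset.mem_erase.2 ⟨Ne.symm huv, hv⟩)
  have : Nontrivial ((S.erase u : Finset V) : Set V) :=
    Set.nontrivial_coe_sort.2 (Finset.one_lt_card_iff_nontrivial.1
      (by rw [Finset.card_erase_of_mem hu]; omega))
  obtain ⟨w, hw⟩ := (not_not.1 hu').preconnected.exists_adj_of_nontrivial ⟨v, hvu⟩
  exact not_adj_of_isDisconn h hv (Finset.mem_of_mem_erase (Finset.mem_coe.1 w.2)) hv' hw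

open Classical in
/-- A set of `k + 1 ≥ 3` vertices is disconnected iff at least `k` of its vertex deletions are. -/
lemma isDisconn_iff_le_card_filter {V : Type*} [DecidableEq V] {G : SimpleGraph V}
    {S : Finset V} {k : ℕ} (hk : 2 ≤ k) (hS : S.card = k + 1) :
    IsDisconn G S ↔ k ≤ (S.filter fun v => IsDisconn G (S.erase v)).card := by
  have hsum := S.card_filter_add_card_filter_not (fun v => IsDisconn G (S.erase v))
  constructor
  · intro h
    have : (S.filter fun v => ¬ IsDisconn G (S.erase v)).card ≤ 1 := by
      refine Finset.card_le_one.2 fun u hu v hv => ?_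
      rw [Finset.mem_filter] at hu hv
      exact eq_of_not_isDisconn_erase (by omega) h hu.1 hv.1 hu.2 hv.2
    omega
  · intro hcard
    by_contra h
    obtain ⟨u, hu, v, hv, huv, hu', hv'⟩ := exists_ne_not_isDisconn_erase (by omega) h
    have : 1 < (S.filter fun v => ¬ IsDisconn G (S.erase v)).card :=
      Finset.one_lt_card.2 ⟨u, Finset.mem_filter.2 ⟨hu, hu'⟩, v, Finset.mem_filter.2 ⟨hv, hv'⟩, huv⟩
    omega

open Classical in
/-- The facets of `Δ_k(G)` containing a ridge `F` correspond to the disconnected vertex deletions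
of the complement of `F`. -/
lemma ncard_isFacet_superset {V : Type*} [Fintype V] [DecidableEq V] (G : SimpleGraph V) {k : ℕ}
    {F : Finset V} (hF : Fᶜ.card = k + 1) :
    {F' : Finset V | IsFacet G k F' ∧ F ⊆ F'}.ncard =
      (Fᶜ.filter fun v => IsDisconn G (Fᶜ.erase v)).card := by
  have hset : {F' : Finset V | IsFacet G k F' ∧ F ⊆ F'} =
      (((Fᶜ.filter fun v => IsDisconn G (Fᶜ.erase v)).image fun v => insert v F :
        Finset (Finset V)) : Set (Finset V)) := by
    ext F'
    simp only [Set.mem_ofPred_eq, Finset.coe_image, Finset.coe_filter, Set.mem_image]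
    constructor
    · rintro ⟨⟨hc, hd⟩, hsub⟩
      have hcard : F'.card = F.card + 1 := by
        have h₁ := F.card_add_card_compl
        have h₂ := F'.card_add_card_compl
        omega
      obtain ⟨v, hv, rfl⟩ := (Finset.covBy_iff_card_sdiff_eq_one.2
        ⟨hsub, by rw [Finset.card_sdiff_of_subset hsub]; omega⟩).exists_finset_insert
      rw [Finset.compl_insert] at hd
      exact ⟨v, ⟨Finset.mem_compl.2 hv, hd⟩, rfl⟩
    · rintro ⟨v, ⟨hv, hd⟩, rfl⟩
      refine ⟨⟨?_, ?_⟩, Finset.subset_insert v F⟩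
      · rw [Finset.compl_insert, Finset.card_erase_of_mem hv, hF, Nat.add_sub_cancel]
      · rwa [Finset.compl_insert]
  rw [hset, Set.ncard_coe_finset, Finset.card_image_of_injOn]
  intro u hu v hv huv
  have hu' := Finset.mem_compl.1 (Finset.mem_filter.1 (Finset.mem_coe.1 hu)).1
  exact (Finset.insert_inj hu').1 huv

/-- A face contained in at least two facets of `Δ_k(G)` has a complement with more than `k`
vertices. -/
lemma lt_card_compl_of_two_le_ncard {V : Type*} [Fintype V] [DecidableEq V] {G : SimpleGraph V}
    {k : ℕ} {F : Finset V} (h : 2 ≤ {F' : Finset V | IsFacet G k F' ∧ F ⊆ F'}.ncard) :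
    k < Fᶜ.card := by
  by_contra! hF
  have hsub : {F' : Finset V | IsFacet G k F' ∧ F ⊆ F'} ⊆ {F} := fun F' hF' =>
    compl_injective <| Finset.eq_of_subset_of_card_le (Finset.compl_subset_compl.2 hF'.2)
      (hF'.1.1.symm ▸ hF)
  have := Set.ncard_le_ncard hsub
  rw [Set.ncard_singleton] at this
  omega

/-- For `k ≥ 2`, the facets of `Δ_{k+1}(G)` are exactly the faces of
`Δ_k(G)` of cardinality `|V| - k - 1` (the ridges of `Δ_k(G)`) that are contained
in at least `k` facets of `Δ_k(G)`. -/
theorem stmt_2 {V : Type*} [Fintype V] [DecidableEq V] (G : SimpleGraph V) (k : ℕ)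
    (hk : 2 ≤ k) :
    ∀ F : Finset V, IsFacet G (k + 1) F ↔
      (F.card = Fintype.card V - (k + 1) ∧ IsFace G k F ∧
        k ≤ {F' : Finset V | IsFacet G k F' ∧ F ⊆ F'}.ncard) := by
  classical
  intro F
  have hF := F.card_add_card_compl
  constructor
  · rintro ⟨hc, hd⟩
    have hle := (isDisconn_iff_le_card_filter hk hc).1 hd
    rw [← ncard_isFacet_superset G hc] at hle
    obtain ⟨F', ⟨hc', hd'⟩, hsub⟩ := Set.nonempty_of_ncard_ne_zero
      (show {F' : Finset V | IsFacet G k F' ∧ F ⊆ F'}.ncard ≠ 0 by omega)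
    exact ⟨by omega, ⟨F'ᶜ, Finset.compl_subset_compl.2 hsub, hc', hd'⟩, hle⟩
  · rintro ⟨hcard, -, hle⟩
    have hlt := lt_card_compl_of_two_le_ncard (hk.trans hle)
    have hc : Fᶜ.card = k + 1 := by omega
    rw [ncard_isFacet_superset G hc] at hle
    exact ⟨hc, (isDisconn_iff_le_card_filter hk hc).2 hle⟩
end

section
/- Let 2 ≤ k ≤ m ≤ n. The k-cut complex Δ_k(K_{m,n}) of the complete bipartite graph is homotopy equivalent to a wedge of C(m-1,k-1)·C(n-1,k-1) spheres of dimension m + n - 2k, where C(a,b) denotes the binomial coefficient. In particular, since its dimension is m + n - k - 1 > m + n - 2k, Δ_k(K_{m,n}) is not shellable. -/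
open Finset

/-- Geometric realization of the simplicial complex with face predicate `K`. -/
noncomputable abbrev Realization {V : Type*} [Fintype V] (K : Finset V → Prop) : Type _ :=
  {f : V → ℝ // (∀ v, 0 ≤ f v) ∧ (∑ v, f v) = 1 ∧ ∃ σ : Finset V, K σ ∧ ∀ v, f v ≠ 0 → v ∈ σ}

/-- The `d`-dimensional sphere. -/
noncomputable abbrev Sphere (d : ℕ) := Metric.sphere (0 : EuclideanSpace ℝ (Fin (d+1))) 1

/-- Wedge of `N` spheres of dimension `d`, glued at the basepoint `b`. -/
noncomputable abbrev WedgeSpheres (N d : ℕ) (b : Sphere d) : Type :=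
  Quot (fun x y : Fin N × Sphere d => x.2 = b ∧ y.2 = b)

open scoped unitInterval

theorem nonempty_homotopyEquiv_of_collapse {X Y : Type*} [TopologicalSpace X] [CompactSpace X]
    [TopologicalSpace Y] [T2Space Y] (q : C(X, Y)) (hq : Function.Surjective q)
    (H : C(I × X, X)) (H0 : ∀ x, H (0, x) = x)
    (hH : ∀ s x y, q x = q y → q (H (s, x)) = q (H (s, y)))
    (H1 : ∀ x y, q x = q y → H (1, x) = H (1, y)) :
    Nonempty (ContinuousMap.HomotopyEquiv X Y) := by
  have hqq : Topology.IsQuotientMap q :=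
    q.continuous.isClosedMap.isQuotientMap q.continuous hq
  have hIq : Topology.IsQuotientMap (Prod.map id q : I × X → I × Y) :=
    (continuous_id.prodMap q.continuous).isClosedMap.isQuotientMap
      (continuous_id.prodMap q.continuous) (Function.surjective_id.prodMap hq)
  choose r hr using hq
  have hg : Continuous fun y => H (1, r y) := by
    rw [hqq.continuous_iff]
    have : (fun y => H (1, r y)) ∘ q = fun x => H (1, x) := by
      ext x
      exact H1 _ _ (hr _)
    rw [this]
    fun_prop
  have hK : Continuous fun p : I × Y => q (H (p.1, r p.2)) := by
    rw [hIq.continuous_iff]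
    have : (fun p : I × Y => q (H (p.1, r p.2))) ∘ (Prod.map id q) = fun p => q (H p) := by
      ext ⟨s, x⟩
      exact hH _ _ _ (hr _)
    rw [this]
    fun_prop
  refine ⟨⟨q, ⟨_, hg⟩, ⟨?_⟩, ⟨?_⟩⟩⟩
  · refine ContinuousMap.Homotopy.symm ⟨H, fun x => H0 x, fun x => ?_⟩
    exact H1 _ _ (hr _).symm
  · refine ContinuousMap.Homotopy.symm ⟨⟨_, hK⟩, fun y => ?_, fun y => ?_⟩
    · simp [H0, hr]
    · simp

theorem homotopic_of_segment {X E : Type*} [TopologicalSpace X] [AddCommGroup E] [Module ℝ E]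
    [TopologicalSpace E] [ContinuousAdd E] [ContinuousSMul ℝ E] {C : Set E} (f g : C(X, C))
    (h : ∀ x, segment ℝ (f x : E) (g x) ⊆ C) : f.Homotopic g := by
  refine ⟨⟨⟨fun p => ⟨(1 - (p.1 : ℝ)) • (f p.2 : E) + (p.1 : ℝ) • (g p.2 : E), ?_⟩, ?_⟩, ?_, ?_⟩⟩
  · exact h p.2 ⟨_, _, by have := p.1.2.2; linarith, p.1.2.1, by ring, rfl⟩
  · fun_prop
  · intro x; ext; simp
  · intro x; ext; simp

/-- A cone without apex is homotopy equivalent to its link. -/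
theorem nonempty_homotopyEquiv_link {E : Type*} [AddCommGroup E] [Module ℝ E]
    [TopologicalSpace E] [ContinuousAdd E] [ContinuousSMul ℝ E] {C : Set E} {l : E → ℝ}
    (hl : Continuous l) (hpos : ∀ x ∈ C, 0 < l x)
    (hsmul : ∀ x ∈ C, ∀ c : ℝ, 0 < c → c • x ∈ C ∧ l (c • x) = c * l x) :
    Nonempty (ContinuousMap.HomotopyEquiv {x // x ∈ C ∧ l x = 1} C) := by
  have hc : Continuous fun x : C => (l x)⁻¹ • (x : E) :=
    (Continuous.inv₀ (f := fun x : C => l x) (by fun_prop) fun x => (hpos x x.2).ne').smul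
      continuous_subtype_val
  have hmem (x : C) : (l x)⁻¹ • (x : E) ∈ C ∧ l ((l x)⁻¹ • (x : E)) = 1 := by
    have h := hpos x x.2
    obtain ⟨h1, h2⟩ := hsmul x x.2 (l x)⁻¹ (inv_pos.2 h)
    exact ⟨h1, by rw [h2, inv_mul_cancel₀ h.ne']⟩
  refine ⟨⟨⟨fun x => ⟨x, x.2.1⟩, by fun_prop⟩, ⟨fun x => ⟨_, hmem x⟩, hc.subtype_mk _⟩, ?_, ?_⟩⟩
  · convert ContinuousMap.Homotopic.refl _
    ext x
    simp [x.2.2]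
  · refine homotopic_of_segment _ _ fun x => ?_
    rintro _ ⟨a, b, ha, hb, hab, rfl⟩
    have h := inv_pos.2 (hpos x x.2)
    have : a • (l x)⁻¹ • (x : E) + b • (x : E) = (a * (l x)⁻¹ + b) • (x : E) := by
      rw [add_smul, mul_smul]
    have hp : 0 < a * (l x)⁻¹ + b := by
      rcases ha.eq_or_lt with rfl | ha
      · simp at hab; simp [hab]
      · positivity
    exact this ▸ (hsmul x x.2 _ hp).1

/-- The collapse of a compact space onto the one-point compactification of an open subspace. -/
theorem exists_collapse {X U : Type*} [TopologicalSpace X] [T2Space X]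
    [TopologicalSpace U] {e : U → X} (he : Topology.IsOpenEmbedding e) :
    ∃ q : C(X, OnePoint U), (∀ u, q (e u) = u) ∧ ∀ x ∉ Set.range e, q x = OnePoint.infty := by
  classical
  let q : X → OnePoint U := fun x =>
    if h : x ∈ Set.range e then (h.choose : OnePoint U) else OnePoint.infty
  have h1 (u : U) : q (e u) = u := by
    have h : e u ∈ Set.range e := ⟨u, rfl⟩
    simp only [q, dif_pos h]
    exact congrArg _ (he.injective h.choose_spec)
  have h2 : ∀ x ∉ Set.range e, q x = OnePoint.infty := fun x h => by simp only [q, dif_neg h]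
  refine ⟨⟨q, ⟨fun s hs => ?_⟩⟩, h1, h2⟩
  rw [OnePoint.isOpen_def] at hs
  by_cases hi : OnePoint.infty ∈ s
  · have : q ⁻¹' s = (e '' ((↑) ⁻¹' s : Set U)ᶜ)ᶜ := by
      ext x
      by_cases hx : x ∈ Set.range e
      · obtain ⟨u, rfl⟩ := hx
        simp [h1, he.injective.eq_iff]
      · simp only [Set.mem_preimage, h2 x hx, hi, true_iff]
        rintro ⟨u, -, rfl⟩
        exact hx ⟨u, rfl⟩
    rw [this]
    exact ((hs.1 hi).image he.continuous).isClosed.isOpen_compl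
  · have : q ⁻¹' s = e '' ((↑) ⁻¹' s : Set U) := by
      ext x
      by_cases hx : x ∈ Set.range e
      · obtain ⟨u, rfl⟩ := hx
        simp [h1, he.injective.eq_iff]
      · simp only [Set.mem_preimage, h2 x hx, hi, false_iff]
        rintro ⟨u, -, rfl⟩
        exact hx ⟨u, rfl⟩
    rw [this]
    exact he.isOpenMap _ hs.2

theorem exists_onePoint_homeomorph_wedgeSpheres {J : Type*} [Fintype J] [Nonempty J]
    [TopologicalSpace J] [DiscreteTopology J] {N d : ℕ} (hJ : Fintype.card J = N) :
    ∃ b : Sphere d,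
      Nonempty (OnePoint (J × EuclideanSpace ℝ (Fin d)) ≃ₜ WedgeSpheres N d b) := by
  let E := EuclideanSpace ℝ (Fin d)
  let φ : OnePoint E ≃ₜ Sphere d := onePointEquivSphereOfFinrankEq (by simp [E])
  let c : Fin N ≃ J := (Fintype.equivFinOfCardEq hJ).symm
  refine ⟨φ OnePoint.infty, ⟨Homeomorph.symm ?_⟩⟩
  let F : Fin N × Sphere d → OnePoint (J × E) :=
    fun p => OnePoint.map (Prod.mk (c p.1)) (φ.symm p.2)
  have hF : Continuous F := by
    refine continuous_prod_of_discrete_left.2 fun i => ?_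
    have h : Topology.IsClosedEmbedding (Prod.mk (c i) : E → J × E) :=
      ⟨isEmbedding_prodMkRight _, by
        rw [show Set.range (Prod.mk (c i) : E → J × E) = {c i} ×ˢ Set.univ by
          ext ⟨x, y⟩; simp [eq_comm]]
        exact (isClosed_discrete _).prod isClosed_univ⟩
    exact (OnePoint.continuous_map h.continuous
      (by simpa only [Filter.coclosedCompact_eq_cocompact] using h.tendsto_cocompact)).comp
        φ.symm.continuous
  have hinf (i : Fin N) : F (i, φ OnePoint.infty) = OnePoint.infty := by simp [F]
  let G : WedgeSpheres N d (φ OnePoint.infty) → OnePoint (J × E) := Quot.lift F (by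
    rintro ⟨i, x⟩ ⟨j, y⟩ ⟨hx, hy⟩
    simp only at hx hy
    rw [hx, hy, hinf, hinf])
  have hG : Continuous G := continuous_quot_lift _ hF
  have hbij : Function.Bijective G := by
    constructor
    · rintro ⟨i, x⟩ ⟨j, y⟩ h
      change F (i, x) = F (j, y) at h
      obtain ⟨x, rfl⟩ := φ.surjective x
      obtain ⟨y, rfl⟩ := φ.surjective y
      induction x using OnePoint.rec with
      | infty =>
        induction y using OnePoint.rec with
        | infty => exact Quot.sound ⟨rfl, rfl⟩
        | coe y => simp [F] at h
      | coe x =>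
        induction y using OnePoint.rec with
        | infty => simp [F] at h
        | coe y =>
          simp only [F, Homeomorph.symm_apply_apply, OnePoint.map_some, OnePoint.coe_eq_coe,
            Prod.mk.injEq, c.injective.eq_iff] at h
          rw [h.1, h.2]
    · intro z
      induction z using OnePoint.rec with
      | infty =>
        exact ⟨Quot.mk _ (c.symm (Classical.arbitrary J), φ OnePoint.infty), hinf _⟩
      | coe z =>
        refine ⟨Quot.mk _ (c.symm z.1, φ (z.2 : OnePoint E)), ?_⟩
        change F _ = _
        simp [F]
  exact Continuous.homeoOfEquivCompactToT2 (f := Equiv.ofBijective G hbij) hG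

/-- The part of the link of a fan in a half space that lies over the relative interiors of a family
of `d`-dimensional coordinate orthants consists of open `d`-cells. -/
theorem exists_isOpenEmbedding_cells {V : Type*} [Fintype V] [DecidableEq V]
    {J : Type*} [TopologicalSpace J] [DiscreteTopology J]
    {C : Set ((V → ℝ) × ℝ)} {A : J → Finset V} {d : ℕ} (hinj : Function.Injective A)
    (hA : ∀ S, (A S).card = d)
    (hC : ∀ S, ∀ v : (V → ℝ) × ℝ, 0 < v.2 → (∀ j ∈ A S, 0 < v.1 j) → (∀ j ∉ A S, v.1 j = 0) →
      v ∈ C)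
    (hmax : ∀ S, ∀ v ∈ C, 0 < v.2 → (∀ j ∈ A S, 0 < v.1 j) → ∀ j ∉ A S, v.1 j = 0) :
    ∃ e : J × EuclideanSpace ℝ (Fin d) → {v // v ∈ C ∧ ‖v‖ = 1},
      Topology.IsOpenEmbedding e ∧
      ∀ v, v ∈ Set.range e ↔ 0 < v.1.2 ∧ ∃ S, ∀ j, j ∈ A S ↔ 0 < v.1.1 j := by
  let E := EuclideanSpace ℝ (Fin d)
  let φ (S : J) : A S ≃ Fin d := Fintype.equivFinOfCardEq (by simp [hA S])
  let w (S : J) (u : E) : V → ℝ := fun j => if h : j ∈ A S then Real.exp (u (φ S ⟨j, h⟩)) else 0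
  let v (S : J) (u : E) : (V → ℝ) × ℝ := (w S u, 1)
  have hvn (S u) : 0 < ‖v S u‖⁻¹ := inv_pos.2 (norm_pos_iff.2 fun h => by
    simpa [v] using congrArg Prod.snd h)
  have hwpos (S : J) (u) : ∀ j ∈ A S, 0 < w S u j := fun j hj => by
    simp only [w, dif_pos hj, Real.exp_pos]
  have hw0 (S : J) (u) : ∀ j ∉ A S, w S u j = 0 := fun j hj => by simp only [w, dif_neg hj]
  have hmem (S u) : ‖v S u‖⁻¹ • v S u ∈ C ∧ ‖‖v S u‖⁻¹ • v S u‖ = 1 := by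
    have h := hvn S u
    refine ⟨hC S _ ?_ (fun j hj => ?_) fun j hj => ?_, ?_⟩
    · exact h.trans_eq (mul_one _).symm
    · simpa [v] using mul_pos h (hwpos S u j hj)
    · simp [v, hw0 S u j hj]
    · rw [norm_smul, norm_inv, norm_norm, inv_mul_cancel₀ (inv_pos.1 h).ne']
  let e (p : J × E) : {v // v ∈ C ∧ ‖v‖ = 1} := ⟨‖v p.1 p.2‖⁻¹ • v p.1 p.2, hmem _ _⟩
  have he2 (p) : 0 < (e p).1.2 :=
    (hvn p.1 p.2).trans_eq (mul_one _).symm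
  have hepos (p) (j) : j ∈ A p.1 ↔ 0 < (e p).1.1 j := by
    constructor
    · intro hj
      simpa [e, v] using mul_pos (hvn p.1 p.2) (hwpos _ p.2 j hj)
    · intro h
      by_contra hj
      simp [e, v, hw0 _ p.2 j hj] at h
  let g (S : J) (x : {v // v ∈ C ∧ ‖v‖ = 1}) : E :=
    WithLp.toLp 2 fun i => Real.log (x.1.1 ((φ S).symm i) / x.1.2)
  have hge (S u) : g S (e (S, u)) = u := by
    ext i
    have h := hvn S u
    simp only [g, e, v, w, Prod.smul_fst, Prod.smul_snd, Pi.smul_apply, smul_eq_mul]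
    rw [dif_pos ((φ S).symm i).2, mul_div_mul_left _ _ h.ne']
    simp
  let O (S : J) : Set {v // v ∈ C ∧ ‖v‖ = 1} := {x | 0 < x.1.2 ∧ ∀ j ∈ A S, 0 < x.1.1 j}
  have hO (S) : IsOpen (O S) := by
    have : O S = {x | 0 < x.1.2} ∩ ⋂ j ∈ A S, {x | 0 < x.1.1 j} := by
      ext x; simp [O]
    rw [this]
    refine (isOpen_lt continuous_const (by fun_prop)).inter
      (isOpen_biInter_finset fun j _ => isOpen_lt continuous_const (by fun_prop))
  have heg (S x) (hx : x ∈ O S) : e (S, g S x) = x := by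
    have hx2 : x.1.2 ≠ 0 := hx.1.ne'
    have hv : v S (g S x) = (x.1.2)⁻¹ • x.1 := by
      refine Prod.ext (funext fun j => ?_) ?_
      · by_cases hj : j ∈ A S
        · simp only [v, w, dif_pos hj, g, Equiv.symm_apply_apply, Prod.smul_fst, Pi.smul_apply]
          rw [Real.exp_log (div_pos (hx.2 j hj) hx.1), smul_eq_mul, div_eq_inv_mul]
        · simp [v, hw0 S _ j hj, hmax S x.1 x.2.1 hx.1 hx.2 j hj]
      · simp [v, hx2]
    ext1
    simp only [e, hv]
    rw [norm_smul, x.2.2, norm_inv, Real.norm_of_nonneg hx.1.le, mul_one, inv_inv, smul_smul,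
      mul_inv_cancel₀ hx2, one_smul]
  refine ⟨e, .of_continuous_injective_isOpenMap ?_ ?_ ?_, fun x => ?_⟩
  · refine continuous_prod_of_discrete_left.2 fun S => ?_
    have hv : Continuous (v S) := by
      refine Continuous.prodMk (continuous_pi fun j => ?_) continuous_const
      by_cases hj : j ∈ A S
      · simp only [w, dif_pos hj]
        exact Real.continuous_exp.comp ((continuous_apply _).comp
          (PiLp.continuous_ofLp 2 fun _ : Fin d => ℝ))
      · simp only [w, dif_neg hj]; fun_prop
    exact ((hv.norm.inv₀ fun u => (inv_pos.1 (hvn S u)).ne').smul hv).subtype_mk _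
  · rintro ⟨S, u⟩ ⟨T, u'⟩ h
    have hST : S = T := by
      refine hinj ?_
      ext j
      rw [hepos (S, u), h, ← hepos (T, u')]
    subst hST
    rw [← hge S u, h, hge]
  · intro s hs
    have : e '' s = ⋃ S, O S ∩ g S ⁻¹' (Prod.mk S ⁻¹' s) := by
      ext x
      simp only [Set.mem_image, Set.mem_iUnion, Set.mem_inter_iff, Set.mem_preimage]
      constructor
      · rintro ⟨⟨S, u⟩, h, rfl⟩
        exact ⟨S, ⟨he2 _, fun j hj => (hepos (S, u) j).1 hj⟩, by rwa [hge]⟩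
      · rintro ⟨S, h, h'⟩
        exact ⟨_, h', heg S x h⟩
    rw [this]
    refine isOpen_iUnion fun S => ContinuousOn.isOpen_inter_preimage ?_ (hO S)
      (hs.preimage (by fun_prop))
    refine (PiLp.continuous_toLp 2 fun _ : Fin d => ℝ).comp_continuousOn
      (continuousOn_pi.2 fun i => ?_)
    refine ContinuousOn.log (ContinuousOn.div (by fun_prop) (by fun_prop) fun x hx => hx.1.ne') ?_
    exact fun x hx => (div_pos (hx.2 _ ((φ S).symm i).2) hx.1).ne'
  · constructor
    · rintro ⟨p, rfl⟩
      exact ⟨he2 p, p.1, hepos p⟩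
    · rintro ⟨h, S, hj⟩
      exact ⟨_, heg S x ⟨h, fun j => (hj j).1⟩⟩

/-- The function `x` vanishes on a set of cardinality `k`. -/
def HasZeros {ι : Type*} (k : ℕ) (x : ι → ℝ) : Prop :=
  ∃ S : Finset ι, S.card = k ∧ ∀ i ∈ S, x i = 0

/-- The cone, without its apex, over the `k`-cut complex of the complete bipartite graph with
parts `ι` and `κ`. -/
def cutCone (ι κ : Type*) (k : ℕ) : Set (ι ⊕ κ → ℝ) :=
  {w | w ≠ 0 ∧ 0 ≤ w ∧ (HasZeros k (w ∘ Sum.inl) ∨ HasZeros k (w ∘ Sum.inr))}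

/-- The product of the cones over two skeleta of simplices and of a line, without the origin. -/
def skeletonFan (ι κ : Type*) (k : ℕ) : Set ((ι ⊕ κ → ℝ) × ℝ) :=
  {v | v ≠ 0 ∧ 0 ≤ v.1 ∧ HasZeros k (v.1 ∘ Sum.inl) ∧ HasZeros k (v.1 ∘ Sum.inr)}

theorem HasZeros.smul {ι : Type*} {k : ℕ} {x : ι → ℝ} (h : HasZeros k x) (c : ℝ) :
    HasZeros k (c • x) :=
  h.imp fun S hS => ⟨hS.1, fun i hi => by simp [hS.2 i hi]⟩

theorem smul_mem_skeletonFan {ι κ : Type*} {k : ℕ} {v : (ι ⊕ κ → ℝ) × ℝ}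
    (hv : v ∈ skeletonFan ι κ k) {c : ℝ} (hc : 0 < c) : c • v ∈ skeletonFan ι κ k :=
  ⟨smul_ne_zero hc.ne' hv.1, smul_nonneg hc.le hv.2.1, hv.2.2.1.smul c, hv.2.2.2.smul c⟩

theorem isClosed_hasZeros {ι : Type*} [Fintype ι] (k : ℕ) :
    IsClosed {x : ι → ℝ | HasZeros k x} := by
  have : {x : ι → ℝ | HasZeros k x} =
      ⋃ S ∈ {S : Finset ι | S.card = k}, ⋂ i ∈ S, {x | x i = 0} := by
    ext x; simp [HasZeros]
  rw [this]
  exact (Set.toFinite _).isClosed_biUnion fun S _ =>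
    isClosed_biInter fun i _ => isClosed_eq (continuous_apply i) continuous_const

/-- The `k`-th smallest coordinate of a nonnegative vector. -/
theorem exists_kthSmallest {ι : Type*} [Fintype ι] {k : ℕ} (hk : 1 ≤ k)
    (hkι : k ≤ Fintype.card ι) :
    ∃ g : (ι → ℝ) → ℝ, Continuous g ∧ (∀ x, 0 ≤ g x) ∧
      (∀ x, ∃ S : Finset ι, S.card = k ∧ ∀ i ∈ S, x i ≤ g x) ∧
      ∀ x, 0 ≤ x → HasZeros k x → ∀ t, 0 ≤ t → g (fun i => x i + t) = t := by
  have hne : (powersetCard k (univ : Finset ι)).Nonempty := powersetCard_nonempty.2 hkι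
  let f (S : Finset ι) (x : ι → ℝ) : NNReal := S.sup fun i => (x i).toNNReal
  refine ⟨fun x => ((powersetCard k univ).inf' hne fun S => f S x : NNReal), ?_,
    fun x => NNReal.coe_nonneg _,
    fun x => ?_, fun x hx h t ht => ?_⟩
  · refine NNReal.continuous_coe.comp (Continuous.finset_inf'_apply hne fun S _ => ?_)
    exact Continuous.finset_sup_apply fun i _ => by fun_prop
  · obtain ⟨S, hS, h⟩ := exists_mem_eq_inf' hne fun S => f S x
    refine ⟨S, (mem_powersetCard.1 hS).2, fun i hi => ?_⟩
    change x i ≤ ((powersetCard k univ).inf' hne fun S => f S x : NNReal)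
    rw [h]
    exact (Real.le_coe_toNNReal _).trans
      (NNReal.coe_le_coe.2 (le_sup (f := fun i => (x i).toNNReal) hi))
  · lift t to NNReal using ht
    refine congrArg NNReal.toReal (le_antisymm ?_ ?_)
    · obtain ⟨S, hS, h⟩ := h
      refine (inf'_le _ (mem_powersetCard.2 ⟨subset_univ S, hS⟩)).trans
        (Finset.sup_le fun i hi => ?_)
      simp [h i hi]
    · refine le_inf' hne _ fun S hS => ?_
      have : S.Nonempty := card_pos.1 (by rw [(mem_powersetCard.1 hS).2]; omega)
      obtain ⟨i, hi⟩ := this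
      refine le_trans ?_ (le_sup (f := fun i => (x i + t).toNNReal) hi)
      exact NNReal.le_toNNReal_of_coe_le (by simpa using hx i)

theorem nonempty_homotopyEquiv_cutCone_skeletonFan {ι κ : Type*} [Fintype ι] [Fintype κ] {k : ℕ}
    (hk : 1 ≤ k) (hkι : k ≤ Fintype.card ι) (hkκ : k ≤ Fintype.card κ) :
    Nonempty (ContinuousMap.HomotopyEquiv (cutCone ι κ k) (skeletonFan ι κ k)) := by
  obtain ⟨g, hgc, hg0, hgS, hgt⟩ := exists_kthSmallest hk hkι
  obtain ⟨h, hhc, hh0, hhS, hht⟩ := exists_kthSmallest hk hkκ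
  have hgz (x) (hx : 0 ≤ x) (hz : HasZeros k x) : g x = 0 := by
    simpa using hgt x hx hz 0 le_rfl
  have hhz (x) (hx : 0 ≤ x) (hz : HasZeros k x) : h x = 0 := by
    simpa using hht x hx hz 0 le_rfl
  have : Nonempty ι := Fintype.card_pos_iff.1 (by omega)
  have : Nonempty κ := Fintype.card_pos_iff.1 (by omega)
  let G (w : ι ⊕ κ → ℝ) : ℝ := g (w ∘ Sum.inl)
  let H (w : ι ⊕ κ → ℝ) : ℝ := h (w ∘ Sum.inr)
  have hGc : Continuous G := hgc.comp (by fun_prop)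
  have hHc : Continuous H := hhc.comp (by fun_prop)
  have hGH (w) (hw : w ∈ cutCone ι κ k) : (G w = 0 ∧ 0 ≤ H w) ∨ (0 ≤ G w ∧ H w = 0) := by
    obtain ⟨-, hw, hz | hz⟩ := hw
    · exact .inl ⟨hgz _ (fun i => hw _) hz, hh0 _⟩
    · exact .inr ⟨hg0 _, hhz _ (fun i => hw _) hz⟩
  let p (w : ι ⊕ κ → ℝ) : (ι ⊕ κ → ℝ) × ℝ :=
    (Sum.elim (fun i => max (w (.inl i) - G w) 0) (fun j => max (w (.inr j) - H w) 0), G w - H w)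
  let r (v : (ι ⊕ κ → ℝ) × ℝ) : ι ⊕ κ → ℝ :=
    Sum.elim (fun i => v.1 (.inl i) + max v.2 0) (fun j => v.1 (.inr j) + max (-v.2) 0)
  have hp : Continuous p := by
    refine Continuous.prodMk (continuous_pi ?_) (by fun_prop)
    rintro (i | j) <;> simp only [Sum.elim_inl, Sum.elim_inr] <;> fun_prop
  have hr : Continuous r := by
    refine continuous_pi ?_
    rintro (i | j) <;> simp only [r, Sum.elim_inl, Sum.elim_inr] <;> fun_prop
  have hpm (w) (hw : w ∈ cutCone ι κ k) : p w ∈ skeletonFan ι κ k := by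
    refine ⟨fun h0 => hw.1 ?_, ?_, ?_, ?_⟩
    · have h2 : G w - H w = 0 := congrArg Prod.snd h0
      have hGw : G w = 0 := by rcases hGH w hw with h | h <;> linarith
      have hHw : H w = 0 := by rcases hGH w hw with h | h <;> linarith
      ext x
      have hx : (p w).1 x = 0 := by rw [h0]; rfl
      have h0 : 0 ≤ w x := hw.2.1 x
      rcases x with i | j
      · simp only [p, Sum.elim_inl, hGw, sub_zero] at hx
        simpa [max_eq_left h0] using hx
      · simp only [p, Sum.elim_inr, hHw, sub_zero] at hx
        simpa [max_eq_left h0] using hx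
    · rintro (i | j) <;> simp [p]
    · obtain ⟨S, hS, h⟩ := hgS (w ∘ Sum.inl)
      exact ⟨S, hS, fun i hi => by simpa [p, G] using h i hi⟩
    · obtain ⟨S, hS, h⟩ := hhS (w ∘ Sum.inr)
      exact ⟨S, hS, fun i hi => by simpa [p, H] using h i hi⟩
  have hrm (v) (hv : v ∈ skeletonFan ι κ k) : r v ∈ cutCone ι κ k := by
    obtain ⟨hv0, hv1, hv2, hv3⟩ := hv
    refine ⟨fun h0 => hv0 ?_, ?_, ?_⟩
    · have hl (i) : v.1 (.inl i) + max v.2 0 = 0 := congrFun h0 (.inl i)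
      have hr (j) : v.1 (.inr j) + max (-v.2) 0 = 0 := congrFun h0 (.inr j)
      have hl1 (i) : 0 ≤ v.1 (.inl i) := hv1 _
      have hr1 (j) : 0 ≤ v.1 (.inr j) := hv1 _
      have h1 := le_max_right v.2 0
      have h2 := le_max_right (-v.2) 0
      refine Prod.ext (funext ?_) ?_
      · rintro (i | j)
        · simpa using (by linarith [hl i, hl1 i] : v.1 (.inl i) = 0)
        · simpa using (by linarith [hr j, hr1 j] : v.1 (.inr j) = 0)
      · have i := Classical.arbitrary ι
        have j := Classical.arbitrary κ
        have h3 := le_max_left v.2 0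
        have h4 := le_max_left (-v.2) 0
        simpa using (by linarith [hl i, hl1 i, hr j, hr1 j] : v.2 = 0)
    · rintro (i | j)
      · exact add_nonneg (hv1 _) (le_max_right _ _)
      · exact add_nonneg (hv1 _) (le_max_right _ _)
    · rcases le_total v.2 0 with h | h
      · obtain ⟨S, hS, hz⟩ := hv2
        exact .inl ⟨S, hS, fun i hi => by have := hz i hi; simp at this; simp [r, this, h]⟩
      · obtain ⟨S, hS, hz⟩ := hv3
        exact .inr ⟨S, hS, fun i hi => by have := hz i hi; simp at this; simp [r, this, h]⟩
  refine ⟨⟨⟨fun w => ⟨p w, hpm w w.2⟩, by fun_prop⟩, ⟨fun v => ⟨r v, hrm v v.2⟩, by fun_prop⟩,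
    (homotopic_of_segment _ _ fun w => ?_).symm, ?_⟩⟩
  · rintro _ ⟨a, b, ha, hb, hab, rfl⟩
    obtain ⟨w, hw⟩ := w
    have hle (x) (hx : 0 ≤ w x) : w x ≤ r (p w) x := by
      rcases x with i | j
      · have := le_max_left (G w - H w) 0
        have := le_max_left (w (.inl i) - G w) 0
        simp only [r, p, Sum.elim_inl]
        rcases hGH w hw with h | h <;> linarith [le_max_right (G w - H w) 0]
      · have := le_max_left (-(G w - H w)) 0
        have := le_max_left (w (.inr j) - H w) 0
        simp only [r, p, Sum.elim_inr]
        rcases hGH w hw with h | h <;> linarith [le_max_right (-(G w - H w)) 0]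
    have hle' (x) : w x ≤ a * w x + b * r (p w) x := by
      have h1 := mul_le_mul_of_nonneg_left (hle x (hw.2.1 x)) hb
      calc w x = (a + b) * w x := by rw [hab, one_mul]
        _ ≤ _ := by linarith
    refine ⟨fun h0 => hw.1 ?_, fun x => (hw.2.1 x).trans (hle' x), ?_⟩
    · ext x
      have h1 : a * w x + b * r (p w) x = 0 := congrFun h0 x
      exact le_antisymm ((hle' x).trans_eq h1) (hw.2.1 x)
    · refine hw.2.2.imp ?_ ?_
      · intro hz
        have hGw := hgz _ (fun i => hw.2.1 _) hz
        obtain ⟨S, hS, hz⟩ := hz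
        refine ⟨S, hS, fun i hi => ?_⟩
        have hz : w (.inl i) = 0 := hz i hi
        have hGw : G w = 0 := hGw
        have hHw : 0 ≤ H w := hh0 _
        simp [r, p, hz, hGw, hHw]
      · intro hz
        have hHw := hhz _ (fun i => hw.2.1 _) hz
        obtain ⟨S, hS, hz⟩ := hz
        refine ⟨S, hS, fun i hi => ?_⟩
        have hz : w (.inr i) = 0 := hz i hi
        have hHw : H w = 0 := hHw
        have hGw : 0 ≤ G w := hg0 _
        simp [r, p, hz, hGw, hHw]
  · convert ContinuousMap.Homotopic.refl _
    refine ContinuousMap.ext fun v => Subtype.ext ?_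
    obtain ⟨v, hv0, hv1, hv2, hv3⟩ := v
    have hG : G (r v) = max v.2 0 :=
      hgt _ (fun i => hv1 _) hv2 _ (le_max_right _ _)
    have hH : H (r v) = max (-v.2) 0 :=
      hht _ (fun i => hv1 _) hv3 _ (le_max_right _ _)
    refine Prod.ext (funext ?_) ?_
    · rintro (i | j)
      · have : 0 ≤ v.1 (.inl i) := hv1 _
        simpa [p, hG, r] using this
      · have : 0 ≤ v.1 (.inr j) := hv1 _
        simpa [p, hH, r] using this
    · change v.2 = (p (r v)).2
      simp only [p, hG, hH]
      rcases le_total v.2 0 with h | h <;> simp [h]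

section Deformation

variable {ι κ : Type*} [Fintype ι] [DecidableEq ι] [Fintype κ] [DecidableEq κ] {k : ℕ}

/-- The function `x` vanishes on a set of cardinality `k` that does not contain `i₀`. -/
def HasZerosAway (k : ℕ) (i₀ : ι) (x : ι → ℝ) : Prop :=
  ∃ S ∈ powersetCard k (univ.erase i₀), ∀ i ∈ S, x i = 0

/-- A nonnegative function that vanishes exactly where `HasZerosAway` holds. -/
def awayProd (k : ℕ) (i₀ : ι) (x : ι → ℝ) : ℝ :=
  ∏ S ∈ powersetCard k (univ.erase i₀), ∑ i ∈ S, x i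

/-- The flow towards the coordinate vector `i₀`. -/
def starFlow (k : ℕ) (i₀ : ι) (s : ℝ) (x : ι → ℝ) : ι → ℝ := fun i =>
  if i = i₀ then (1 - s) * x i +
    ∑ S ∈ powersetCard k (univ.erase i₀), ∏ j ∈ S, max (s - (1 - s) * x j) 0
  else max ((1 - s) * x i - s) 0

theorem HasZerosAway.smul {i₀ : ι} {x : ι → ℝ} (h : HasZerosAway k i₀ x) (c : ℝ) :
    HasZerosAway k i₀ (c • x) :=
  h.imp fun S hS => ⟨hS.1, fun i hi => by simp [hS.2 i hi]⟩

theorem awayProd_nonneg (i₀ : ι) {x : ι → ℝ} (hx : 0 ≤ x) : 0 ≤ awayProd k i₀ x :=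
  prod_nonneg fun _ _ => sum_nonneg fun i _ => hx i

theorem awayProd_eq_zero_iff {i₀ : ι} {x : ι → ℝ} (hx : 0 ≤ x) :
    awayProd k i₀ x = 0 ↔ HasZerosAway k i₀ x := by
  rw [awayProd, prod_eq_zero_iff]
  exact exists_congr fun S => and_congr_right fun _ => sum_eq_zero_iff_of_nonneg fun i _ => hx i

theorem starFlow_nonneg (i₀ : ι) {s : ℝ} (hs : s ≤ 1) {x : ι → ℝ} (hx : 0 ≤ x) :
    0 ≤ starFlow k i₀ s x := fun i => by
  unfold starFlow
  split_ifs
  · exact add_nonneg (mul_nonneg (by linarith) (hx i))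
      (sum_nonneg fun S _ => prod_nonneg fun j _ => le_max_right _ _)
  · exact le_max_right _ _

theorem starFlow_zero (hk : 1 ≤ k) (i₀ : ι) {x : ι → ℝ} (hx : 0 ≤ x) :
    starFlow k i₀ 0 x = x := by
  ext i
  have hx' (i) : 0 ≤ x i := hx i
  have : ∑ S ∈ powersetCard k (univ.erase i₀), ∏ j ∈ S, max (0 - (1 - 0) * x j) 0 = 0 := by
    refine sum_eq_zero fun S hS => ?_
    obtain ⟨j, hj⟩ : S.Nonempty := card_pos.1 (by rw [(mem_powersetCard.1 hS).2]; omega)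
    exact prod_eq_zero hj (by simp [hx'])
  simp only [starFlow, this]
  split_ifs <;> simp [hx']

theorem starFlow_one (i₀ : ι) (x y : ι → ℝ) : starFlow k i₀ 1 x = starFlow k i₀ 1 y := by
  ext i; simp [starFlow]

theorem HasZerosAway.starFlow {i₀ : ι} {s : ℝ} (hs : 0 ≤ s) {x : ι → ℝ}
    (h : HasZerosAway k i₀ x) : HasZerosAway k i₀ (starFlow k i₀ s x) := by
  obtain ⟨S, hS, hz⟩ := h
  refine ⟨S, hS, fun i hi => ?_⟩
  have : i ≠ i₀ := (mem_erase.1 ((mem_powersetCard.1 hS).1 hi)).1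
  simp [_root_.starFlow, this, hz i hi, hs]

theorem HasZeros.starFlow {i₀ : ι} {s : ℝ} (hs : 0 ≤ s) {x : ι → ℝ}
    (h : HasZeros k x) : HasZeros k (starFlow k i₀ s x) := by
  by_cases hα : ∑ S ∈ powersetCard k (univ.erase i₀), ∏ j ∈ S, max (s - (1 - s) * x j) 0 = 0
  · obtain ⟨S, hS, hz⟩ := h
    refine ⟨S, hS, fun i hi => ?_⟩
    simp only [_root_.starFlow, hα, hz i hi]
    split_ifs <;> simp [hs]
  · obtain ⟨S, hS, hS'⟩ := exists_ne_zero_of_sum_ne_zero hα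
    refine ⟨S, (mem_powersetCard.1 hS).2, fun i hi => ?_⟩
    have hi0 : i ≠ i₀ := (mem_erase.1 ((mem_powersetCard.1 hS).1 hi)).1
    have hne := (prod_ne_zero_iff.1 hS') i hi
    simp only [_root_.starFlow, if_neg hi0, max_eq_right_iff]
    by_contra! hlt
    exact hne (max_eq_right (by linarith))

theorem le_of_starFlow_eq_zero {i₀ : ι} {s t : ℝ} (hs : s < 1) (hst : s = (1 - s) * t)
    (ht : 0 ≤ t) {x : ι → ℝ} (hx : 0 ≤ x) (h : starFlow k i₀ s x = 0) :
    (∀ i, x i ≤ t) ∧ ∀ S ∈ powersetCard k (univ.erase i₀), t ≤ ∑ i ∈ S, x i := by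
  have hs' : 0 < 1 - s := by linarith
  have hα0 : ∀ S ∈ powersetCard k (univ.erase i₀), 0 ≤ ∏ j ∈ S, max (s - (1 - s) * x j) 0 :=
    fun S _ => prod_nonneg fun j _ => le_max_right _ _
  have h0 : (1 - s) * x i₀ +
      ∑ S ∈ powersetCard k (univ.erase i₀), ∏ j ∈ S, max (s - (1 - s) * x j) 0 = 0 := by
    simpa [starFlow] using congrFun h i₀
  have h1 : 0 ≤ (1 - s) * x i₀ := mul_nonneg hs'.le (hx i₀)
  have h2 := sum_nonneg hα0
  refine ⟨fun i => ?_, fun S hS => ?_⟩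
  · refine le_of_mul_le_mul_left ?_ hs'
    by_cases hi : i = i₀
    · subst hi
      have := mul_nonneg hs'.le ht
      linarith
    · have := congrFun h i
      simp only [starFlow, if_neg hi, Pi.zero_apply, max_eq_right_iff] at this
      linarith
  · have := (sum_eq_zero_iff_of_nonneg hα0).1 (by linarith) S hS
    obtain ⟨j, hj, hj0⟩ := prod_eq_zero_iff.1 this
    rw [max_eq_right_iff, hst] at hj0
    refine (le_of_mul_le_mul_left (a := 1 - s) ?_ hs').trans
      (single_le_sum (f := x) (fun i _ => hx i) hj)
    rw [← hst] at hj0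
    linarith

theorem continuous_starFlow (i₀ : ι) :
    Continuous fun p : ℝ × (ι → ℝ) => starFlow k i₀ p.1 p.2 := by
  refine continuous_pi fun i => ?_
  unfold starFlow
  split_ifs <;> fun_prop

theorem continuous_awayProd (i₀ : ι) : Continuous (awayProd k i₀) := by
  unfold awayProd
  fun_prop

theorem exists_support_of_not_hasZerosAway {i₀ : ι} {x : ι → ℝ} (hx : 0 ≤ x) (h : HasZeros k x)
    (h' : ¬ HasZerosAway k i₀ x) :
    ∃ A ∈ powersetCard (Fintype.card ι - k) (univ.erase i₀), ∀ i, i ∈ A ↔ 0 < x i := by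
  classical
  let Z : Finset ι := {i | x i = 0}
  have hZ : Zᶜ.card = Fintype.card ι - Z.card := card_compl Z
  obtain ⟨S, hS, hz⟩ := h
  have hSZ : S ⊆ Z := fun i hi => by simp [Z, hz i hi]
  have hlt : ¬ k ≤ (Z.erase i₀).card := fun hle => by
    obtain ⟨T, hT, hTk⟩ := exists_subset_card_eq hle
    exact h' ⟨T, mem_powersetCard.2 ⟨hT.trans (erase_subset_erase _ (subset_univ _)), hTk⟩,
      fun i hi => by simpa [Z] using mem_of_mem_erase (hT hi)⟩
  have hle := card_le_card hSZ
  have hi0 : i₀ ∈ Z := by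
    by_contra hi
    rw [erase_eq_of_notMem hi] at hlt
    omega
  rw [card_erase_of_mem hi0] at hlt
  refine ⟨Zᶜ, mem_powersetCard.2 ⟨fun i hi => ?_, by rw [hZ]; omega⟩, fun i => ?_⟩
  · exact mem_erase.2 ⟨fun h => (mem_compl.1 hi) (h ▸ hi0), mem_univ _⟩
  · simpa [Z] using (hx i).lt_iff_ne'.symm

theorem not_hasZerosAway_of_support {i₀ : ι} {x : ι → ℝ} {A : Finset ι}
    (hA : A ∈ powersetCard (Fintype.card ι - k) (univ.erase i₀)) (hx : ∀ i ∈ A, 0 < x i) :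
    ¬ HasZerosAway k i₀ x := by
  rintro ⟨S, hS, hz⟩
  rw [mem_powersetCard] at hA hS
  have hd : Disjoint S A := Finset.disjoint_left.2 fun i hi hi' => (hx i hi').ne' (hz i hi)
  have h1 := card_le_card (union_subset hS.1 hA.1)
  rw [card_union_of_disjoint hd, card_erase_of_mem (mem_univ i₀), card_univ] at h1
  have : 0 < Fintype.card ι := Fintype.card_pos_iff.2 ⟨i₀⟩
  omega

theorem hasZeros_of_support (hk : k ≤ Fintype.card ι) {x : ι → ℝ} {A : Finset ι}
    (hA : A.card = Fintype.card ι - k) (hx : ∀ i ∉ A, x i = 0) : HasZeros k x :=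
  ⟨Aᶜ, by rw [card_compl]; omega, fun i hi => hx i (mem_compl.1 hi)⟩

theorem HasZeros.eq_zero_of_support {x : ι → ℝ} (h : HasZeros k x) {A : Finset ι}
    (hA : A.card = Fintype.card ι - k) (hx : ∀ i ∈ A, 0 < x i) : ∀ i ∉ A, x i = 0 := by
  obtain ⟨S, hS, hz⟩ := h
  have hsub : S ⊆ Aᶜ := fun i hi => mem_compl.2 fun hi' => (hx i hi').ne' (hz i hi)
  have := eq_of_subset_of_card_le hsub (by rw [card_compl]; have := card_le_univ S; omega)
  exact fun i hi => hz i (this ▸ mem_compl.2 hi)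

/-- The flow on the product fan. -/
def fanFlow (k : ℕ) (i₀ : ι) (j₀ : κ) (s : ℝ) (v : (ι ⊕ κ → ℝ) × ℝ) : (ι ⊕ κ → ℝ) × ℝ :=
  (Sum.elim (starFlow k i₀ s (v.1 ∘ Sum.inl)) (starFlow k j₀ s (v.1 ∘ Sum.inr)),
    (1 - s) * v.2 - s)

/-- The subset of the product fan that is contracted by the flow. -/
def flowStar (k : ℕ) (i₀ : ι) (j₀ : κ) : Set ((ι ⊕ κ → ℝ) × ℝ) :=
  {v | v.2 ≤ 0 ∨ HasZerosAway k i₀ (v.1 ∘ Sum.inl) ∨ HasZerosAway k j₀ (v.1 ∘ Sum.inr)}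

/-- A nonnegative function on the product fan that vanishes exactly on `flowStar`. -/
def flowDefect (k : ℕ) (i₀ : ι) (j₀ : κ) (v : (ι ⊕ κ → ℝ) × ℝ) : ℝ :=
  max v.2 0 * (awayProd k i₀ (v.1 ∘ Sum.inl) * awayProd k j₀ (v.1 ∘ Sum.inr))

theorem flowDefect_nonneg (i₀ : ι) (j₀ : κ) {v : (ι ⊕ κ → ℝ) × ℝ} (hv : 0 ≤ v.1) :
    0 ≤ flowDefect k i₀ j₀ v :=
  mul_nonneg (le_max_right _ _)
    (mul_nonneg (awayProd_nonneg _ fun _ => hv _) (awayProd_nonneg _ fun _ => hv _))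

theorem flowDefect_eq_zero {i₀ : ι} {j₀ : κ} {v : (ι ⊕ κ → ℝ) × ℝ} (hv : 0 ≤ v.1)
    (h : v ∈ flowStar k i₀ j₀) : flowDefect k i₀ j₀ v = 0 := by
  rcases h with h | h | h
  · simp [flowDefect, h]
  · simp [flowDefect, (awayProd_eq_zero_iff (x := v.1 ∘ Sum.inl) fun _ => hv _).2 h]
  · simp [flowDefect, (awayProd_eq_zero_iff (x := v.1 ∘ Sum.inr) fun _ => hv _).2 h]

theorem continuous_flowDefect (i₀ : ι) (j₀ : κ) : Continuous (flowDefect k i₀ j₀) := by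
  have h1 := (continuous_awayProd (k := k) i₀).comp
    (f := fun v : (ι ⊕ κ → ℝ) × ℝ => v.1 ∘ Sum.inl) (by fun_prop)
  have h2 := (continuous_awayProd (k := k) j₀).comp
    (f := fun v : (ι ⊕ κ → ℝ) × ℝ => v.1 ∘ Sum.inr) (by fun_prop)
  exact Continuous.mul (by fun_prop) (h1.mul h2)

theorem continuous_fanFlow (i₀ : ι) (j₀ : κ) :
    Continuous fun p : ℝ × ((ι ⊕ κ → ℝ) × ℝ) => fanFlow k i₀ j₀ p.1 p.2 := by
  have h1 := (continuous_starFlow (k := k) i₀).comp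
    (f := fun p : ℝ × ((ι ⊕ κ → ℝ) × ℝ) => (p.1, p.2.1 ∘ Sum.inl)) (by fun_prop)
  have h2 := (continuous_starFlow (k := k) j₀).comp
    (f := fun p : ℝ × ((ι ⊕ κ → ℝ) × ℝ) => (p.1, p.2.1 ∘ Sum.inr)) (by fun_prop)
  refine Continuous.prodMk (continuous_pi ?_) (by fun_prop)
  rintro (i | j)
  · exact (continuous_apply i).comp h1
  · exact (continuous_apply j).comp h2

theorem fanFlow_zero (hk : 1 ≤ k) (i₀ : ι) (j₀ : κ) {v : (ι ⊕ κ → ℝ) × ℝ} (hv : 0 ≤ v.1) :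
    fanFlow k i₀ j₀ 0 v = v := by
  refine Prod.ext (funext ?_) (by simp [fanFlow])
  rintro (i | j)
  · simp [fanFlow, starFlow_zero hk i₀ (x := v.1 ∘ Sum.inl) fun _ => hv _]
  · simp [fanFlow, starFlow_zero hk j₀ (x := v.1 ∘ Sum.inr) fun _ => hv _]

theorem fanFlow_one (i₀ : ι) (j₀ : κ) (v w : (ι ⊕ κ → ℝ) × ℝ) :
    fanFlow k i₀ j₀ 1 v = fanFlow k i₀ j₀ 1 w := by
  simp only [fanFlow, starFlow_one i₀ (v.1 ∘ Sum.inl) (w.1 ∘ Sum.inl),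
    starFlow_one j₀ (v.1 ∘ Sum.inr) (w.1 ∘ Sum.inr), sub_self, zero_mul]

theorem fanFlow_mem_flowStar {i₀ : ι} {j₀ : κ} {s : ℝ} (hs : s ∈ I) {v : (ι ⊕ κ → ℝ) × ℝ}
    (h : v ∈ flowStar k i₀ j₀) : fanFlow k i₀ j₀ s v ∈ flowStar k i₀ j₀ := by
  rcases h with h | h | h
  · refine .inl ?_
    have := mul_nonpos_of_nonneg_of_nonpos (sub_nonneg.2 hs.2) h
    simp only [fanFlow]
    linarith [hs.1]
  · exact .inr (.inl (h.starFlow hs.1))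
  · exact .inr (.inr (h.starFlow hs.1))

theorem fanFlow_mem_skeletonFan (hk : 1 ≤ k) {i₀ : ι} {j₀ : κ} {s : ℝ} (hs : s ∈ I)
    {v : (ι ⊕ κ → ℝ) × ℝ} (hv : v ∈ skeletonFan ι κ k) (hv1 : ‖v‖ = 1)
    (hsv : s ≤ max (1 - flowDefect k i₀ j₀ v) 0) :
    fanFlow k i₀ j₀ s v ∈ skeletonFan ι κ k := by
  obtain ⟨hv0, hvn, hvl, hvr⟩ := hv
  refine ⟨fun h0 => ?_, ?_, hvl.starFlow hs.1, hvr.starFlow hs.1⟩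
  · have h1 : starFlow k i₀ s (v.1 ∘ Sum.inl) = 0 :=
      congrArg (fun z : (ι ⊕ κ → ℝ) × ℝ => z.1 ∘ Sum.inl) h0
    have h2 : starFlow k j₀ s (v.1 ∘ Sum.inr) = 0 :=
      congrArg (fun z : (ι ⊕ κ → ℝ) × ℝ => z.1 ∘ Sum.inr) h0
    have h3 : (1 - s) * v.2 - s = 0 := congrArg Prod.snd h0
    have hs1 : s < 1 := hs.2.lt_of_ne (by rintro rfl; simp at h3)
    have ht : 0 ≤ v.2 := by
      refine nonneg_of_mul_nonneg_right (a := 1 - s) ?_ (by linarith)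
      linarith [hs.1]
    have h4 := le_of_starFlow_eq_zero hs1 (by linarith) ht (x := v.1 ∘ Sum.inl) (fun _ => hvn _) h1
    have h5 := le_of_starFlow_eq_zero hs1 (by linarith) ht (x := v.1 ∘ Sum.inr) (fun _ => hvn _) h2
    have ht1 : 1 ≤ v.2 := by
      rw [← hv1]
      refine norm_prod_le_iff.2 ⟨(pi_norm_le_iff_of_nonneg ht).2 ?_, (Real.norm_of_nonneg ht).le⟩
      rintro (i | j)
      · exact (Real.norm_of_nonneg (hvn _)).trans_le (h4.1 i)
      · exact (Real.norm_of_nonneg (hvn _)).trans_le (h5.1 j)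
    have hd : 1 ≤ flowDefect k i₀ j₀ v :=
      one_le_mul_of_one_le_of_one_le (ht1.trans (le_max_left _ _))
        (one_le_mul_of_one_le_of_one_le
          (Finset.one_le_prod fun S hS => ht1.trans (h4.2 S hS))
          (Finset.one_le_prod fun S hS => ht1.trans (h5.2 S hS)))
    rw [max_eq_right (by linarith)] at hsv
    obtain rfl : s = 0 := le_antisymm hsv hs.1
    exact hv0 (fanFlow_zero hk i₀ j₀ hvn ▸ h0)
  · rintro (i | j)
    · exact starFlow_nonneg i₀ hs.2 (fun _ => hvn _) i
    · exact starFlow_nonneg j₀ hs.2 (fun _ => hvn _) j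

theorem smul_mem_flowStar {i₀ : ι} {j₀ : κ} {v : (ι ⊕ κ → ℝ) × ℝ} (hv : v ∈ flowStar k i₀ j₀)
    {c : ℝ} (hc : 0 ≤ c) : c • v ∈ flowStar k i₀ j₀ := by
  rcases hv with h | h | h
  · exact .inl (mul_nonpos_of_nonneg_of_nonpos hc h)
  · exact .inr (.inl (h.smul c))
  · exact .inr (.inr (h.smul c))

/-- The supports of the cones that are complementary to `flowStar`. -/
abbrev CellSupport (k : ℕ) (i₀ : ι) (j₀ : κ) : Type _ :=
  {A : Finset (ι ⊕ κ) // A.toLeft ∈ powersetCard (Fintype.card ι - k) (univ.erase i₀) ∧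
    A.toRight ∈ powersetCard (Fintype.card κ - k) (univ.erase j₀)}

theorem card_cellSupport (hk : 1 ≤ k) (hkι : k ≤ Fintype.card ι) (hkκ : k ≤ Fintype.card κ)
    (i₀ : ι) (j₀ : κ) : Fintype.card (CellSupport k i₀ j₀) =
      (Fintype.card ι - 1).choose (k - 1) * (Fintype.card κ - 1).choose (k - 1) := by
  let P := powersetCard (Fintype.card ι - k) (univ.erase i₀)
  let Q := powersetCard (Fintype.card κ - k) (univ.erase j₀)
  have e : CellSupport k i₀ j₀ ≃ {p : Finset ι × Finset κ // p ∈ P ×ˢ Q} :=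
    sumEquiv.toEquiv.subtypeEquiv fun A => by simp [sumEquiv, P, Q]
  rw [Fintype.card_congr e, Fintype.card_coe, card_product, card_powersetCard, card_powersetCard,
    card_erase_of_mem (mem_univ _), card_erase_of_mem (mem_univ _), card_univ, card_univ,
    Nat.choose_symm_of_eq_add (a := Fintype.card ι - k) (b := k - 1) (by omega),
    Nat.choose_symm_of_eq_add (a := Fintype.card κ - k) (b := k - 1) (by omega)]

theorem notMem_flowStar_iff {i₀ : ι} {j₀ : κ} {v : (ι ⊕ κ → ℝ) × ℝ}
    (hv : v ∈ skeletonFan ι κ k) :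
    v ∉ flowStar k i₀ j₀ ↔ 0 < v.2 ∧ ∃ A : CellSupport k i₀ j₀, ∀ x, x ∈ A.1 ↔ 0 < v.1 x := by
  simp only [flowStar, Set.mem_ofPred_eq, not_or, not_le]
  refine and_congr_right fun _ => ⟨fun ⟨h1, h2⟩ => ?_, fun ⟨A, hA⟩ => ⟨?_, ?_⟩⟩
  · obtain ⟨A, hA, hA'⟩ := exists_support_of_not_hasZerosAway (x := v.1 ∘ Sum.inl)
      (fun _ => hv.2.1 _) hv.2.2.1 h1
    obtain ⟨B, hB, hB'⟩ := exists_support_of_not_hasZerosAway (x := v.1 ∘ Sum.inr)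
      (fun _ => hv.2.1 _) hv.2.2.2 h2
    refine ⟨⟨A.disjSum B, by simpa using hA, by simpa using hB⟩, ?_⟩
    rintro (i | j)
    · simpa using hA' i
    · simpa using hB' j
  · exact not_hasZerosAway_of_support A.2.1 fun i hi => (hA _).1 (mem_toLeft.1 hi)
  · exact not_hasZerosAway_of_support A.2.2 fun i hi => (hA _).1 (mem_toRight.1 hi)

theorem nonempty_homotopyEquiv_link_wedgeSpheres (hk : 1 ≤ k) (hkι : k ≤ Fintype.card ι)
    (hkκ : k ≤ Fintype.card κ) {d N : ℕ} (hd : d = Fintype.card ι + Fintype.card κ - 2 * k)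
    (hN : N = (Fintype.card ι - 1).choose (k - 1) * (Fintype.card κ - 1).choose (k - 1)) :
    ∃ b : Sphere d, Nonempty (ContinuousMap.HomotopyEquiv
      {v // v ∈ skeletonFan ι κ k ∧ ‖v‖ = 1} (WedgeSpheres N d b)) := by
  obtain ⟨i₀⟩ : Nonempty ι := Fintype.card_pos_iff.1 (by omega)
  obtain ⟨j₀⟩ : Nonempty κ := Fintype.card_pos_iff.1 (by omega)
  have hcard : Fintype.card (CellSupport k i₀ j₀) = N := by
    rw [hN, card_cellSupport hk hkι hkκ]
  let _ : TopologicalSpace (CellSupport k i₀ j₀) := ⊥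
  have : DiscreteTopology (CellSupport k i₀ j₀) := ⟨rfl⟩
  have : Nonempty (CellSupport k i₀ j₀) := Fintype.card_pos_iff.1 (by
    rw [hcard, hN]
    exact Nat.mul_pos (Nat.choose_pos (by omega)) (Nat.choose_pos (by omega)))
  obtain ⟨b, ⟨φ⟩⟩ := exists_onePoint_homeomorph_wedgeSpheres (d := d) hcard
  refine ⟨b, ?_⟩
  let L := {v // v ∈ skeletonFan ι κ k ∧ ‖v‖ = 1}
  obtain ⟨e, he, her⟩ := exists_isOpenEmbedding_cells (C := skeletonFan ι κ k) (d := d)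
    (A := fun A : CellSupport k i₀ j₀ => A.1) Subtype.val_injective
    (fun A => by
      have h1 := (mem_powersetCard.1 A.2.1).2
      have h2 := (mem_powersetCard.1 A.2.2).2
      rw [← card_toLeft_add_card_toRight, h1, h2]
      omega)
    (fun A v hv hpos hz => by
      refine ⟨fun h => ?_, fun x => ?_, ?_, ?_⟩
      · rw [h] at hv
        exact lt_irrefl _ hv
      · by_cases hx : x ∈ A.1
        · exact (hpos x hx).le
        · exact (hz x hx).ge
      · exact hasZeros_of_support hkι (mem_powersetCard.1 A.2.1).2
          fun i hi => hz _ fun h => hi (mem_toLeft.2 h)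
      · exact hasZeros_of_support hkκ (mem_powersetCard.1 A.2.2).2
          fun i hi => hz _ fun h => hi (mem_toRight.2 h))
    (fun A v hv _ hpos => by
      rintro (i | j) hx
      · exact hv.2.2.1.eq_zero_of_support (mem_powersetCard.1 A.2.1).2
          (fun i hi => hpos _ (mem_toLeft.1 hi)) i fun h => hx (mem_toLeft.1 h)
      · exact hv.2.2.2.eq_zero_of_support (mem_powersetCard.1 A.2.2).2
          (fun i hi => hpos _ (mem_toRight.1 hi)) j fun h => hx (mem_toRight.1 h))
  have hrange (v : L) : v ∈ Set.range e ↔ v.1 ∉ flowStar k i₀ j₀ := by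
    rw [her, notMem_flowStar_iff v.2.1]
  obtain ⟨q, hqe, hqi⟩ := exists_collapse he
  have hq (x y : L) (h : q x = q y) :
      x = y ∨ (x.1 ∈ flowStar k i₀ j₀ ∧ y.1 ∈ flowStar k i₀ j₀) := by
    by_cases hx : x ∈ Set.range e <;> by_cases hy : y ∈ Set.range e
    · obtain ⟨u, rfl⟩ := hx
      obtain ⟨u', rfl⟩ := hy
      rw [hqe, hqe, OnePoint.coe_eq_coe] at h
      exact .inl (congrArg e h)
    · obtain ⟨u, rfl⟩ := hx
      rw [hqe, hqi _ hy] at h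
      exact absurd h (OnePoint.coe_ne_infty _)
    · obtain ⟨u, rfl⟩ := hy
      rw [hqe, hqi _ hx] at h
      exact absurd h (OnePoint.infty_ne_coe _)
    · exact .inr ⟨not_not.1 (mt (hrange x).2 hx), not_not.1 (mt (hrange y).2 hy)⟩
  have hqs (x : L) (h : x.1 ∈ flowStar k i₀ j₀) : q x = OnePoint.infty :=
    hqi x fun hx => (hrange x).1 hx h
  have hsurj : Function.Surjective q := by
    intro z
    induction z using OnePoint.rec with
    | infty =>
      have h0 : ((0, -1) : (ι ⊕ κ → ℝ) × ℝ) ∈ skeletonFan ι κ k := by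
        refine ⟨fun h => ?_, le_rfl, ?_, ?_⟩
        · simpa using congrArg Prod.snd h
        · obtain ⟨S, -, hS⟩ := exists_subset_card_eq (s := (univ : Finset ι)) hkι
          exact ⟨S, hS, fun _ _ => rfl⟩
        · obtain ⟨S, -, hS⟩ := exists_subset_card_eq (s := (univ : Finset κ)) hkκ
          exact ⟨S, hS, fun _ _ => rfl⟩
      exact ⟨⟨_, h0, by simp [Prod.norm_def]⟩, hqs _ (.inl (by simp))⟩
    | coe u => exact ⟨e u, hqe u⟩
  have : CompactSpace L := by
    refine isCompact_iff_compactSpace.1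
      (?_ : IsCompact {v : (ι ⊕ κ → ℝ) × ℝ | v ∈ skeletonFan ι κ k ∧ ‖v‖ = 1})
    have : {v : (ι ⊕ κ → ℝ) × ℝ | v ∈ skeletonFan ι κ k ∧ ‖v‖ = 1} = Metric.sphere 0 1 ∩
        ({v | 0 ≤ v.1} ∩ ({v | HasZeros k (v.1 ∘ Sum.inl)} ∩
          {v | HasZeros k (v.1 ∘ Sum.inr)})) := by
      ext v
      simp only [skeletonFan, Set.mem_ofPred_eq, Set.mem_inter_iff, mem_sphere_zero_iff_norm]
      constructor
      · rintro ⟨⟨-, h⟩, h'⟩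
        exact ⟨h', h⟩
      · rintro ⟨h', h⟩
        exact ⟨⟨norm_ne_zero_iff.1 (by rw [h']; exact one_ne_zero), h⟩, h'⟩
    rw [this]
    refine (isCompact_sphere _ _).inter_right (IsClosed.inter ?_ (IsClosed.inter ?_ ?_))
    · exact isClosed_le continuous_const continuous_fst
    · exact (isClosed_hasZeros k).preimage (by fun_prop)
    · exact (isClosed_hasZeros k).preimage (by fun_prop)
  let τ (p : I × L) : ℝ := p.1 * max (1 - flowDefect k i₀ j₀ p.2.1) 0
  have hτI (p) : τ p ∈ I :=
    ⟨mul_nonneg p.1.2.1 (le_max_right _ _), mul_le_one₀ p.1.2.2 (le_max_right _ _)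
      (max_le (by linarith [flowDefect_nonneg (k := k) i₀ j₀ p.2.2.1.2.1]) zero_le_one)⟩
  let F (p : I × L) : (ι ⊕ κ → ℝ) × ℝ := fanFlow k i₀ j₀ (τ p) p.2.1
  have hF (p) : F p ∈ skeletonFan ι κ k :=
    fanFlow_mem_skeletonFan hk (hτI p) p.2.2.1 p.2.2.2
      (mul_le_of_le_one_left (le_max_right _ _) p.1.2.2)
  have hFn (p) : 0 < ‖F p‖ := norm_pos_iff.2 (hF p).1
  have hFc : Continuous F := by
    have hc : Continuous fun p : I × L => p.2.1 := continuous_subtype_val.comp continuous_snd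
    refine (continuous_fanFlow i₀ j₀).comp (Continuous.prodMk ?_ hc)
    have := (continuous_flowDefect (k := k) i₀ j₀).comp hc
    exact Continuous.mul (by fun_prop) ((continuous_const.sub this).max continuous_const)
  let H : C(I × L, L) := ⟨fun p => ⟨‖F p‖⁻¹ • F p,
    smul_mem_skeletonFan (hF p) (inv_pos.2 (hFn p)), by
      rw [norm_smul, norm_inv, norm_norm, inv_mul_cancel₀ (hFn p).ne']⟩,
    ((hFc.norm.inv₀ fun p => (hFn p).ne').smul hFc).subtype_mk _⟩
  refine (nonempty_homotopyEquiv_of_collapse q hsurj H (fun x => ?_) (fun s x y h => ?_)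
    fun x y h => ?_).map fun E => E.trans φ.toHomotopyEquiv
  · have : F (0, x) = x.1 := by
      simp only [F, τ, Set.Icc.coe_zero, zero_mul]
      exact fanFlow_zero hk i₀ j₀ x.2.1.2.1
    ext1
    simp [H, this, x.2.2]
  · rcases hq x y h with rfl | ⟨hx, hy⟩
    · rfl
    · rw [hqs, hqs]
      · exact smul_mem_flowStar (fanFlow_mem_flowStar (hτI (s, y)) hy)
          (inv_nonneg.2 (norm_nonneg _))
      · exact smul_mem_flowStar (fanFlow_mem_flowStar (hτI (s, x)) hx)
          (inv_nonneg.2 (norm_nonneg _))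
  · rcases hq x y h with rfl | ⟨hx, hy⟩
    · rfl
    · have : F (1, x) = F (1, y) := by
        simp only [F, τ, flowDefect_eq_zero x.2.1.2.1 hx, flowDefect_eq_zero y.2.1.2.1 hy]
        simpa using fanFlow_one i₀ j₀ _ _
      ext1
      simp [H, this]

end Deformation

theorem isDisconn_completeBipartiteGraph_iff {ι κ : Type*} {S : Finset (ι ⊕ κ)}
    (hS : 2 ≤ S.card) :
    IsDisconn (completeBipartiteGraph ι κ) S ↔ (∀ x ∈ S, x.isLeft) ∨ ∀ x ∈ S, x.isRight := by
  let G := (completeBipartiteGraph ι κ).induce (S : Set (ι ⊕ κ))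
  have hadj {x y} (hx : x ∈ S) (hy : y ∈ S) (h : (completeBipartiteGraph ι κ).Adj x y) :
      G.Reachable ⟨x, hx⟩ ⟨y, hy⟩ := SimpleGraph.Adj.reachable (G := G) h
  constructor
  · intro h
    by_contra! hn
    obtain ⟨⟨x, hx, hxl⟩, y, hy, hyr⟩ := hn
    obtain ⟨b, rfl⟩ : ∃ b, x = .inr b := by cases x <;> simp_all
    obtain ⟨a, rfl⟩ : ∃ a, y = .inl a := by cases y <;> simp_all
    refine h (SimpleGraph.connected_iff_exists_forall_reachable _ |>.2 ⟨⟨_, hy⟩, ?_⟩)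
    rintro ⟨a' | b', hz⟩
    · exact (hadj hy hx (by simp)).trans (hadj hx hz (by simp))
    · exact hadj hy hz (by simp)
  · intro h hc
    have hbot : G = ⊥ := by
      ext ⟨x, hx⟩ ⟨y, hy⟩
      have hx' : x ∈ S := hx
      have hy' : y ∈ S := hy
      simp only [G, SimpleGraph.induce_adj, completeBipartiteGraph_adj, SimpleGraph.bot_adj,
        iff_false]
      rcases h with h | h <;> have h1 := h x hx' <;> have h2 := h y hy' <;>
        cases x <;> cases y <;> simp_all
    obtain ⟨x, hx, y, hy, hxy⟩ := one_lt_card.1 hS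
    have hr : G.Reachable ⟨x, hx⟩ ⟨y, hy⟩ := hc.preconnected _ _
    rw [hbot, SimpleGraph.reachable_bot] at hr
    exact hxy (congrArg Subtype.val hr)

theorem exists_isFace_completeBipartiteGraph_iff {ι κ : Type*} [Fintype ι] [DecidableEq ι]
    [Fintype κ] [DecidableEq κ] {k : ℕ} (hk : 2 ≤ k) (f : ι ⊕ κ → ℝ) :
    (∃ T, IsFace (completeBipartiteGraph ι κ) k T ∧ ∀ v, f v ≠ 0 → v ∈ T) ↔
      HasZeros k (f ∘ Sum.inl) ∨ HasZeros k (f ∘ Sum.inr) := by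
  constructor
  · rintro ⟨T, ⟨S, hS, rfl, hd⟩, hf⟩
    have hz (v) (hv : v ∈ S) : f v = 0 := by
      by_contra h
      exact mem_compl.1 (hS hv) (hf v h)
    have hcard := card_toLeft_add_card_toRight (u := S)
    rcases (isDisconn_completeBipartiteGraph_iff hk).1 hd with h | h
    · refine .inl ⟨S.toLeft, ?_, fun i hi => hz _ (mem_toLeft.1 hi)⟩
      have : S.toRight = ∅ := eq_empty_of_forall_notMem fun j hj => by
        simpa using h _ (mem_toRight.1 hj)
      simpa [this] using hcard
    · refine .inr ⟨S.toRight, ?_, fun j hj => hz _ (mem_toRight.1 hj)⟩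
      have : S.toLeft = ∅ := eq_empty_of_forall_notMem fun i hi => by
        simpa using h _ (mem_toLeft.1 hi)
      simpa [this] using hcard
  · have key (S : Finset (ι ⊕ κ)) (hS : S.card = k) (hz : ∀ v ∈ S, f v = 0)
        (h : (∀ x ∈ S, x.isLeft) ∨ ∀ x ∈ S, x.isRight) :
        ∃ T, IsFace (completeBipartiteGraph ι κ) k T ∧ ∀ v, f v ≠ 0 → v ∈ T :=
      ⟨Sᶜ, ⟨S, (compl_compl S).ge, hS, (isDisconn_completeBipartiteGraph_iff (hS ▸ hk)).2 h⟩,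
        fun v hv => mem_compl.2 fun hv' => hv (hz v hv')⟩
    rintro (⟨S, hS, hz⟩ | ⟨S, hS, hz⟩)
    · exact key (S.map .inl) (by simpa) (by simpa using hz) (.inl (by simp))
    · exact key (S.map .inr) (by simpa) (by simpa using hz) (.inr (by simp))

theorem realization_isFace_iff {ι κ : Type*} [Fintype ι] [DecidableEq ι]
    [Fintype κ] [DecidableEq κ] {k : ℕ} (hk : 2 ≤ k) (f : ι ⊕ κ → ℝ) :
    ((∀ v, 0 ≤ f v) ∧ ∑ v, f v = 1 ∧
      ∃ T, IsFace (completeBipartiteGraph ι κ) k T ∧ ∀ v, f v ≠ 0 → v ∈ T) ↔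
      f ∈ cutCone ι κ k ∧ ∑ v, f v = 1 := by
  rw [exists_isFace_completeBipartiteGraph_iff hk]
  constructor
  · rintro ⟨h0, h1, h⟩
    exact ⟨⟨by rintro rfl; simp at h1, h0, h⟩, h1⟩
  · rintro ⟨⟨-, h0, h⟩, h1⟩
    exact ⟨h0, h1, h⟩

theorem exists_homotopyEquiv_realization_wedgeSpheres {ι κ : Type*} [Fintype ι] [DecidableEq ι]
    [Fintype κ] [DecidableEq κ] {k : ℕ} (hk : 2 ≤ k) (hkι : k ≤ Fintype.card ι)
    (hkκ : k ≤ Fintype.card κ) {d N : ℕ} (hd : d = Fintype.card ι + Fintype.card κ - 2 * k)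
    (hN : N = (Fintype.card ι - 1).choose (k - 1) * (Fintype.card κ - 1).choose (k - 1)) :
    ∃ b : Sphere d, Nonempty (ContinuousMap.HomotopyEquiv
      (Realization (IsFace (completeBipartiteGraph ι κ) k)) (WedgeSpheres N d b)) := by
  have hk1 : 1 ≤ k := by omega
  obtain ⟨b, ⟨e₄⟩⟩ := nonempty_homotopyEquiv_link_wedgeSpheres hk1 hkι hkκ hd hN
  let e₀ : Realization (IsFace (completeBipartiteGraph ι κ) k) ≃ₜ
      {f // f ∈ cutCone ι κ k ∧ ∑ v, f v = 1} :=
    (Homeomorph.refl _).subtype (realization_isFace_iff hk)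
  obtain ⟨e₁⟩ := nonempty_homotopyEquiv_link (C := cutCone ι κ k) (l := fun f => ∑ v, f v)
    (by fun_prop)
    (fun f hf => (sum_nonneg fun v _ => hf.2.1 v).lt_of_ne' fun h => hf.1 (funext fun v =>
      (sum_eq_zero_iff_of_nonneg fun v _ => hf.2.1 v).1 h v (mem_univ v)))
    (fun f hf c hc => ⟨⟨smul_ne_zero hc.ne' hf.1, smul_nonneg hc.le hf.2.1,
      hf.2.2.imp (fun h => h.smul c) fun h => h.smul c⟩, (mul_sum _ _ _).symm⟩)
  obtain ⟨e₂⟩ := nonempty_homotopyEquiv_cutCone_skeletonFan hk1 hkι hkκ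
  obtain ⟨e₃⟩ := nonempty_homotopyEquiv_link (C := skeletonFan ι κ k) (l := fun v => ‖v‖)
    continuous_norm (fun v hv => norm_pos_iff.2 hv.1)
    fun v hv c hc => ⟨smul_mem_skeletonFan hv hc, by rw [norm_smul, Real.norm_of_nonneg hc.le]⟩
  exact ⟨b, ⟨(e₀.toHomotopyEquiv.trans e₁).trans (e₂.trans (e₃.symm.trans e₄))⟩⟩

theorem not_shellable_completeBipartiteGraph {ι κ : Type*} [Fintype ι] [DecidableEq ι]
    [Fintype κ] [DecidableEq κ] {k : ℕ} (hk : 2 ≤ k) (hkι : k ≤ Fintype.card ι)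
    (hkκ : k ≤ Fintype.card κ) : ¬ Shellable (IsFacet (completeBipartiteGraph ι κ) k) := by
  rintro ⟨l, -, hl, hsh⟩
  have hfac (F : Finset (ι ⊕ κ)) : F ∈ l ↔
      Fᶜ.card = k ∧ ((∀ x ∈ Fᶜ, x.isLeft) ∨ ∀ x ∈ Fᶜ, x.isRight) := by
    rw [hl, IsFacet]
    exact and_congr_right fun h => isDisconn_completeBipartiteGraph_iff (h ▸ hk)
  let P (F : Finset (ι ⊕ κ)) : Prop := ∀ x ∈ Fᶜ, x.isLeft
  have hmem {i : ℕ} (hi : i < l.length) : l.getD i ∅ ∈ l := by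
    rw [List.getD_eq_getElem _ _ hi]
    exact List.getElem_mem hi
  obtain ⟨F₁, hF₁, hP₁⟩ : ∃ F ∈ l, P F := by
    obtain ⟨S, -, hS⟩ := exists_subset_card_eq (s := (univ : Finset ι)) hkι
    refine ⟨(S.map .inl)ᶜ, (hfac _).2 ?_, ?_⟩ <;> simp [P, hS]
  obtain ⟨F₂, hF₂, hP₂⟩ : ∃ F ∈ l, ¬ P F := by
    obtain ⟨S, -, hS⟩ := exists_subset_card_eq (s := (univ : Finset κ)) hkκ
    have : S.Nonempty := card_pos.1 (by omega)
    refine ⟨(S.map .inr)ᶜ, (hfac _).2 ?_, ?_⟩ <;> simp [P, hS]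
    exact this
  have hex : ∃ j, j < l.length ∧ ¬ (P (l.getD j ∅) ↔ P (l.getD 0 ∅)) := by
    by_contra! hn
    have hiff (F) (hF : F ∈ l) : P F ↔ P (l.getD 0 ∅) := by
      obtain ⟨i, hi, rfl⟩ := List.getElem_of_mem hF
      simpa [hi] using hn i hi
    exact hP₂ ((hiff _ hF₂).2 ((hiff _ hF₁).1 hP₁))
  classical
  obtain ⟨hj, hPj⟩ := Nat.find_spec hex
  set j := Nat.find hex
  have hj0 : 0 < j := Nat.pos_of_ne_zero fun h => by simp [h] at hPj
  obtain ⟨i, hij, -, hcard⟩ := hsh 0 j hj0 hj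
  have hPi : P (l.getD i ∅) ↔ P (l.getD 0 ∅) := by
    by_contra h
    exact Nat.find_min hex hij ⟨hij.trans hj, h⟩
  obtain ⟨hBk, hB⟩ := (hfac _).1 (hmem (hij.trans hj))
  obtain ⟨hCk, hC⟩ := (hfac _).1 (hmem hj)
  have hdisj : Disjoint (l.getD i ∅)ᶜ (l.getD j ∅)ᶜ := by
    rw [Finset.disjoint_left]
    intro x hx hx'
    have : ¬ (P (l.getD i ∅) ↔ P (l.getD j ∅)) := by tauto
    rcases hB with hB | hB <;> rcases hC with hC | hC
    · tauto
    · have h1 := hB x hx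
      have h2 := hC x hx'
      cases x <;> simp_all
    · have h1 := hB x hx
      have h2 := hC x hx'
      cases x <;> simp_all
    · refine this (iff_of_false (fun h => ?_) fun h => ?_)
      · have h1 := hB x hx
        have h2 := h x hx
        cases x <;> simp_all
      · have h1 := hC x hx'
        have h2 := h x hx'
        cases x <;> simp_all
  have h1 := card_union_of_disjoint hdisj
  rw [← compl_inter] at h1
  have h2 := card_add_card_compl (l.getD i ∅ ∩ l.getD j ∅)
  have h3 := card_add_card_compl (l.getD j ∅)
  omega

/-- For `2 ≤ k ≤ m ≤ n`, the `k`-cut complex of `K_{m,n}` is homotopy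
equivalent to a wedge of `C(m-1,k-1)·C(n-1,k-1)` spheres of dimension `m + n - 2k`;
in particular it is not shellable. -/
theorem stmt_8 (m n k : ℕ) (hk2 : 2 ≤ k) (hkm : k ≤ m) (hmn : m ≤ n) :
    (∃ b : Sphere (m + n - 2 * k),
      Nonempty
        (ContinuousMap.HomotopyEquiv
          (Realization (IsFace (completeBipartiteGraph (Fin m) (Fin n)) k))
          (WedgeSpheres ((m - 1).choose (k - 1) * (n - 1).choose (k - 1))
            (m + n - 2 * k) b))) ∧
    ¬ Shellable (IsFacet (completeBipartiteGraph (Fin m) (Fin n)) k) := by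
  refine ⟨?_, ?_⟩
  · exact exists_homotopyEquiv_realization_wedgeSpheres hk2 (by simpa)
      (by simpa using hkm.trans hmn) (by simp) (by simp)
  · exact not_shellable_completeBipartiteGraph hk2 (by simpa) (by simpa using hkm.trans hmn)
end
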